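/- arXiv:2402.19147 — 2 statements merged into one kernel-verified Lean document; each statement's English description precedes it below -/
import Mathlib

section
/- (Lemma 2, second inequality) Let X and E be m×n quaternion matrices and set X̃ = X + E. Fix a row-selection map r : {1,…,t} → {1,…,m} and let R = X(I,:), R̃ = X̃(I,:), and E_I = E(I,:) be the corresponding row submatrices (so R̃ = R + E_I). Let R⁺ and R̃⁺ be Moore–Penrose pseudoinverses of R and R̃, and assume X = X R⁺ R. Then ‖X − X̃ R̃⁺ R̃‖_F ≤ ‖E_I‖_F · ‖X R⁺‖_F + ‖E‖_F. -/
open Matrix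

/-- The Frobenius norm of a quaternion matrix: `√(∑ i j, |A i j|²)`. -/
noncomputable def frobNorm {α β : Type*} [Fintype α] [Fintype β]
    (A : Matrix α β (Quaternion ℝ)) : ℝ :=
  Real.sqrt (∑ i, ∑ j, ‖A i j‖ ^ 2)

/-- `U` is a Moore–Penrose pseudoinverse of `A`:
`A U A = A`, `U A U = U`, `(A U)ᴴ = A U`, `(U A)ᴴ = U A`. -/
def IsMoorePenrose {α β : Type*} [Fintype α] [Fintype β]
    (A : Matrix α β (Quaternion ℝ)) (U : Matrix β α (Quaternion ℝ)) : Prop :=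
  A * U * A = A ∧ U * A * U = U ∧ (A * U)ᴴ = A * U ∧ (U * A)ᴴ = U * A

lemma sq_le_help {a b : ℝ} (h : a ^ 2 ≤ b ^ 2) (hb : 0 ≤ b) : a ≤ b :=
  le_of_abs_le (abs_le_of_sq_le_sq h hb)

lemma frob_sq {α β : Type*} [Fintype α] [Fintype β] (A : Matrix α β (Quaternion ℝ)) :
    frobNorm A ^ 2 = ∑ i, ∑ j, ‖A i j‖ ^ 2 :=
  Real.sq_sqrt (by positivity)

lemma frob_nonneg {α β : Type*} [Fintype α] [Fintype β] (A : Matrix α β (Quaternion ℝ)) :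
    0 ≤ frobNorm A := Real.sqrt_nonneg _

lemma frob_sq_re {α β : Type*} [Fintype α] [Fintype β] (A : Matrix α β (Quaternion ℝ)) :
    frobNorm A ^ 2 = ∑ i, ((A * Aᴴ) i i).re := by
  rw [frob_sq]
  refine Finset.sum_congr rfl fun i _ => ?_
  have h : (A * Aᴴ) i i = ((∑ j, ‖A i j‖ ^ 2 : ℝ) : Quaternion ℝ) := by
    rw [Matrix.mul_apply, ← Quaternion.algebraMap_def, map_sum]
    refine Finset.sum_congr rfl fun j _ => ?_
    rw [Matrix.conjTranspose_apply, Quaternion.self_mul_star, Quaternion.normSq_eq_norm_mul_self,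
      sq, Quaternion.algebraMap_def]
  rw [h, Quaternion.re_coe]

section
attribute [local instance] Matrix.frobeniusNormedAddCommGroup

lemma frob_eq_norm {α β : Type*} [Fintype α] [Fintype β] (A : Matrix α β (Quaternion ℝ)) :
    frobNorm A = ‖A‖ := by
  rw [Matrix.frobenius_norm_def, frobNorm, Real.sqrt_eq_rpow]
  simp

lemma frob_sub {α β : Type*} [Fintype α] [Fintype β] (A B : Matrix α β (Quaternion ℝ)) :
    frobNorm (-A - B) ≤ frobNorm A + frobNorm B := by
  simp only [frob_eq_norm]
  calc ‖-A - B‖ ≤ ‖-A‖ + ‖B‖ := norm_sub_le _ _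
    _ = _ := by rw [norm_neg]
end

lemma frob_mul {α β γ : Type*} [Fintype α] [Fintype β] [Fintype γ]
    (A : Matrix α β (Quaternion ℝ)) (B : Matrix β γ (Quaternion ℝ)) :
    frobNorm (A * B) ≤ frobNorm A * frobNorm B := by
  refine sq_le_help ?_ (mul_nonneg (frob_nonneg _) (frob_nonneg _))
  rw [mul_pow, frob_sq, frob_sq, frob_sq, Finset.sum_mul]
  refine Finset.sum_le_sum fun i _ => ?_
  rw [Finset.sum_comm (f := fun i j => ‖B i j‖ ^ 2), Finset.mul_sum]
  refine Finset.sum_le_sum fun j _ => ?_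
  refine le_trans ?_ (Finset.sum_mul_sq_le_sq_mul_sq _ _ _)
  rw [Matrix.mul_apply]
  gcongr
  refine (norm_sum_le _ _).trans (le_of_eq ?_)
  simp

lemma frob_proj {α β : Type*} [Fintype α] [Fintype β] [DecidableEq β]
    (A : Matrix α β (Quaternion ℝ)) (P : Matrix β β (Quaternion ℝ))
    (h1 : Pᴴ = P) (h2 : P * P = P) :
    frobNorm (A * P) ^ 2 + frobNorm (A * (1 - P)) ^ 2 = frobNorm A ^ 2 := by
  simp only [frob_sq_re]
  rw [← Finset.sum_add_distrib]
  refine Finset.sum_congr rfl fun i _ => ?_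
  rw [← Quaternion.re_add, ← Matrix.add_apply]
  congr 2
  have e1 : (A * P) * (A * P)ᴴ = A * P * Aᴴ := by
    rw [conjTranspose_mul, h1, ← Matrix.mul_assoc, Matrix.mul_assoc A P P, h2]
  have h3 : (1 - P) * (1 - P) = 1 - P := by
    rw [Matrix.mul_sub, Matrix.sub_mul, Matrix.sub_mul, h2]; simp
  have e2 : (A * (1 - P)) * (A * (1 - P))ᴴ = A * (1 - P) * Aᴴ := by
    rw [conjTranspose_mul, conjTranspose_sub, h1, conjTranspose_one, ← Matrix.mul_assoc,
      Matrix.mul_assoc A (1 - P) (1 - P), h3]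
  rw [e1, e2, ← Matrix.add_mul, ← Matrix.mul_add]; simp; rfl

/-- Lemma 2, second inequality. -/
theorem quaternion_CUR_row_perturbation {m n t : ℕ}
    (X E : Matrix (Fin m) (Fin n) (Quaternion ℝ))
    (Xt : Matrix (Fin m) (Fin n) (Quaternion ℝ)) (hXt : Xt = X + E)
    (r : Fin t → Fin m)
    (R : Matrix (Fin t) (Fin n) (Quaternion ℝ)) (hR : R = X.submatrix r id)
    (Rt : Matrix (Fin t) (Fin n) (Quaternion ℝ)) (hRt : Rt = Xt.submatrix r id)
    (EI : Matrix (Fin t) (Fin n) (Quaternion ℝ)) (hEI : EI = E.submatrix r id)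
    (Rp : Matrix (Fin n) (Fin t) (Quaternion ℝ)) (hRp : IsMoorePenrose R Rp)
    (Rtp : Matrix (Fin n) (Fin t) (Quaternion ℝ)) (hRtp : IsMoorePenrose Rt Rtp)
    (hXRR : X = X * Rp * R) :
    frobNorm (X - Xt * Rtp * Rt) ≤ frobNorm EI * frobNorm (X * Rp) + frobNorm E := by
  obtain ⟨a, b, -, d⟩ := hRtp
  have h2 : (Rtp * Rt) * (Rtp * Rt) = Rtp * Rt := by
    rw [← Matrix.mul_assoc, b]
  have hRE : R = Rt - EI := by
    subst hXt hR hRt hEI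
    rw [Matrix.submatrix_add]
    exact (add_sub_cancel_right _ _).symm
  have hz : Rt * (1 - Rtp * Rt) = 0 := by
    rw [Matrix.mul_sub, ← Matrix.mul_assoc, a]; simp
  have key : X - Xt * Rtp * Rt = -(X * Rp * (EI * (1 - Rtp * Rt))) - E * (Rtp * Rt) := by
    have : X * (1 - Rtp * Rt) = -(X * Rp * (EI * (1 - Rtp * Rt))) := by
      conv_lhs => rw [hXRR, Matrix.mul_assoc, hRE, Matrix.sub_mul, hz]
      simp
    rw [← this, hXt, Matrix.mul_assoc, Matrix.add_mul, Matrix.mul_sub, Matrix.mul_one]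
    abel
  have q1 := frob_proj EI _ d h2
  have q2 := frob_proj E _ d h2
  have q3 : frobNorm (EI * (1 - Rtp * Rt)) ≤ frobNorm EI :=
    sq_le_help (by nlinarith [sq_nonneg (frobNorm (EI * (Rtp * Rt)))]) (frob_nonneg _)
  have q4 : frobNorm (E * (Rtp * Rt)) ≤ frobNorm E :=
    sq_le_help (by nlinarith [sq_nonneg (frobNorm (E * (1 - Rtp * Rt)))]) (frob_nonneg _)
  rw [key]
  refine (frob_sub _ _).trans (add_le_add ?_ q4)
  rw [mul_comm (frobNorm EI)]
  exact (frob_mul _ _).trans (mul_le_mul_of_nonneg_left q3 (frob_nonneg _))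
end

section
/- Let X and X̃ be m×n quaternion matrices, C̃ an m×s quaternion matrix with Moore–Penrose pseudoinverse C̃⁺, and R̃ a t×n quaternion matrix with Moore–Penrose pseudoinverse R̃⁺. Then ‖X − C̃ C̃⁺ X̃ R̃⁺ R̃‖_F ≤ ‖X − C̃ C̃⁺ X̃‖_F + ‖X̃ (I_n − R̃⁺ R̃)‖_F. -/
open Matrix

section Helpers

lemma frobNorm_sq_eq {m n : ℕ} (A : Matrix (Fin m) (Fin n) (Quaternion ℝ)) :
    ∑ i, ∑ j, ‖A i j‖ ^ 2 = ((Aᴴ * A).trace).re := by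
  have hre : ∀ {k : ℕ} (f : Fin k → Quaternion ℝ), (∑ i, f i).re = ∑ i, (f i).re := by
    intro k f
    exact map_sum (⟨⟨fun q : Quaternion ℝ => q.re, rfl⟩, fun _ _ => rfl⟩ : Quaternion ℝ →+ ℝ) f _
  rw [Matrix.trace, hre, Finset.sum_comm]
  refine Finset.sum_congr rfl fun j _ => ?_
  rw [Matrix.diag_apply, Matrix.mul_apply, hre]
  refine Finset.sum_congr rfl fun i _ => ?_
  rw [Matrix.conjTranspose_apply, Quaternion.star_mul_self, Quaternion.re_coe,
    Quaternion.normSq_eq_norm_mul_self, sq]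

lemma frobNorm_proj_le {m n : ℕ} (P : Matrix (Fin m) (Fin m) (Quaternion ℝ))
    (hP : P * P = P) (hH : Pᴴ = P) (A : Matrix (Fin m) (Fin n) (Quaternion ℝ)) :
    frobNorm (P * A) ≤ frobNorm A := by
  apply Real.sqrt_le_sqrt
  have h0 : (0 : ℝ) ≤ ∑ i, ∑ j, ‖(A - P * A) i j‖ ^ 2 := by positivity
  have e : Aᴴ * A = (P * A)ᴴ * (P * A) + (A - P * A)ᴴ * (A - P * A) := by
    have h1 : P * (P * A) = P * A := by rw [← Matrix.mul_assoc, hP]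
    simp only [Matrix.conjTranspose_sub, Matrix.conjTranspose_mul, hH, Matrix.sub_mul,
      Matrix.mul_sub, Matrix.mul_assoc, h1]
    abel
  rw [frobNorm_sq_eq] at h0
  rw [frobNorm_sq_eq, frobNorm_sq_eq, e, Matrix.trace_add, Quaternion.re_add]
  linarith

attribute [local instance] Matrix.frobeniusNormedAddCommGroup in
lemma frobNorm_add_le {m n : ℕ} (A B : Matrix (Fin m) (Fin n) (Quaternion ℝ)) :
    frobNorm (A + B) ≤ frobNorm A + frobNorm B := by
  have h : ∀ A : Matrix (Fin m) (Fin n) (Quaternion ℝ), frobNorm A = ‖A‖ := by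
    intro A
    rw [Matrix.frobenius_norm_def, frobNorm, Real.sqrt_eq_rpow]
    norm_cast
  rw [h, h, h]
  exact norm_add_le A B

end Helpers

/-- splitting the CUR error. -/
theorem quaternion_CUR_error_split {m n s t : ℕ}
    (X Xt : Matrix (Fin m) (Fin n) (Quaternion ℝ))
    (Ct : Matrix (Fin m) (Fin s) (Quaternion ℝ))
    (Ctp : Matrix (Fin s) (Fin m) (Quaternion ℝ)) (hCtp : IsMoorePenrose Ct Ctp)
    (Rt : Matrix (Fin t) (Fin n) (Quaternion ℝ))
    (Rtp : Matrix (Fin n) (Fin t) (Quaternion ℝ)) (hRtp : IsMoorePenrose Rt Rtp) :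
    frobNorm (X - Ct * Ctp * Xt * Rtp * Rt) ≤
      frobNorm (X - Ct * Ctp * Xt) + frobNorm (Xt * (1 - Rtp * Rt)) := by
  have e : X - Ct * Ctp * Xt * Rtp * Rt =
      (X - Ct * Ctp * Xt) + (Ct * Ctp) * (Xt * (1 - Rtp * Rt)) := by
    simp only [Matrix.mul_sub, Matrix.mul_one, Matrix.mul_assoc]
    abel
  rw [e]
  refine (frobNorm_add_le _ _).trans (add_le_add le_rfl (frobNorm_proj_le _ ?_ hCtp.2.2.1 _))
  rw [← Matrix.mul_assoc, hCtp.1]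
end
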